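/- Let A, B ⊊ I be proper subsets such that ℓ(d_B d_A) = |A| + |B|. Then there exist proper subsets A', B' ⊊ I with d_{B'} d_{A'} = d_B d_A, |A'| + |B'| = |A| + |B|, and B' ⊆ A' − 1. -/

import Mathlib

/-- `x : Equiv.Perm ℤ` is an affine permutation in `S̃_{k+1}`: it commutes with
translation by `k+1` and its window sums to `(k+1)(k+2)/2`. -/
def IsAffinePerm (k : ℕ) (x : Equiv.Perm ℤ) : Prop :=
  (∀ i : ℤ, x (i + (k + 1)) = x i + (k + 1)) ∧
  ∑ i ∈ Finset.Icc (1 : ℤ) (k + 1), x i = (k + 1) * (k + 2) / 2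

/-- The underlying function of the simple generator `s_i`. -/
def sAffFun (k : ℕ) (i : ZMod (k + 1)) (j : ℤ) : ℤ :=
  if (j : ZMod (k + 1)) = i then j + 1
  else if (j : ZMod (k + 1)) = i + 1 then j - 1
  else j

theorem sAffFun_invol (k : ℕ) (i : ZMod (k + 1)) (h : ¬ (1 : ZMod (k + 1)) = 0) :
    Function.Involutive (sAffFun k i) := by
  have hne : i + 1 ≠ i := fun hc => h (by
    have h2 : i + 1 = i + 0 := by simpa using hc
    exact add_left_cancel h2)
  intro j
  by_cases h1 : (j : ZMod (k + 1)) = i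
  · have e1 : sAffFun k i j = j + 1 := if_pos h1
    have hj1 : ((j + 1 : ℤ) : ZMod (k + 1)) = i + 1 := by push_cast; rw [h1]
    have e2 : sAffFun k i (j + 1) = j := by
      unfold sAffFun
      rw [if_neg (by rw [hj1]; exact hne), if_pos hj1]
      ring
    rw [e1, e2]
  · by_cases h2 : (j : ZMod (k + 1)) = i + 1
    · have e1 : sAffFun k i j = j - 1 := by unfold sAffFun; rw [if_neg h1, if_pos h2]
      have hj1 : ((j - 1 : ℤ) : ZMod (k + 1)) = i := by push_cast; rw [h2]; ring
      have e2 : sAffFun k i (j - 1) = j := by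
        unfold sAffFun; rw [if_pos hj1]; ring
      rw [e1, e2]
    · have e1 : sAffFun k i j = j := by unfold sAffFun; rw [if_neg h1, if_neg h2]
      rw [e1, e1]

/-- The simple generator `s_i` of the affine symmetric group, as a permutation of `ℤ`:
it interchanges `m(k+1) + ī` and `m(k+1) + ī + 1` for every `m` (when `k ≥ 1`). -/
noncomputable def sAff (k : ℕ) (i : ZMod (k + 1)) : Equiv.Perm ℤ :=
  if h : (1 : ZMod (k + 1)) = 0 then 1 else Function.Involutive.toPerm _ (sAffFun_invol k i h)

/-- The Coxeter length of `x`: the least number of simple generators whose product is `x`. -/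
noncomputable def affLen (k : ℕ) (x : Equiv.Perm ℤ) : ℕ :=
  sInf {n : ℕ | ∃ w : List (ZMod (k + 1)), w.length = n ∧ x = (w.map (sAff k)).prod}

/-- The right descent set `D_R(x) = {i : ℓ(x s_i) < ℓ(x)}`. -/
noncomputable def rightDescents (k : ℕ) (x : Equiv.Perm ℤ) : Set (ZMod (k + 1)) :=
  {i | affLen k (x * sAff k i) < affLen k x}

/-- The cyclic interval `[i,j] = {i, i+1, …, j}` of residues mod `k+1`. -/
def cycInt (k : ℕ) (i j : ZMod (k + 1)) : Finset (ZMod (k + 1)) :=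
  (Finset.range ((j - i).val + 1)).image fun t : ℕ => i + (t : ZMod (k + 1))

/-- A choice of a "gate" residue not belonging to `A` (when `A` is proper). -/
noncomputable def gate (k : ℕ) (A : Finset (ZMod (k + 1))) : ZMod (k + 1) :=
  if h : ∃ g, g ∉ A then h.choose else 0

/-- The cyclically decreasing element `d_A`: the product of the `s_a`, `a ∈ A`, in an
order where `s_{a+1}` occurs to the left of `s_a` whenever `a, a+1 ∈ A`. -/
noncomputable def dElt (k : ℕ) (A : Finset (ZMod (k + 1))) : Equiv.Perm ℤ :=
  (((((List.range (k + 1)).reverse.map fun t : ℕ => gate k A + (t : ZMod (k + 1))).filter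
      fun a => decide (a ∈ A)).map (sAff k)).prod)

/-- The cyclically increasing element `u_A`: the product of the `s_a`, `a ∈ A`, in an
order where `s_{a+1}` occurs to the right of `s_a` whenever `a, a+1 ∈ A`. -/
noncomputable def uElt (k : ℕ) (A : Finset (ZMod (k + 1))) : Equiv.Perm ℤ :=
  ((((List.range (k + 1)).map fun t : ℕ => gate k A + (t : ZMod (k + 1))).filter
      fun a => decide (a ∈ A)).map (sAff k)).prod

/-- The right decreasing code: `CRD(x)_i = #{j < ī : x(j) > x(ī)}`. -/
noncomputable def CRD (k : ℕ) (x : Equiv.Perm ℤ) (i : ZMod (k + 1)) : ℕ :=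
  Set.ncard {j : ℤ | j < (i.val : ℤ) ∧ x (i.val : ℤ) < x j}

/-- The right increasing code: `CRI(x)_i = #{j > ī + 1 : x(j) < x(ī + 1)}`. -/
noncomputable def CRI (k : ℕ) (x : Equiv.Perm ℤ) (i : ZMod (k + 1)) : ℕ :=
  Set.ncard {j : ℤ | (i.val : ℤ) + 1 < j ∧ x j < x ((i.val : ℤ) + 1)}

/-- The left decreasing code: `CLD(x)_i = #{j < x⁻¹(ī + 1) : x(j) > ī + 1}`. -/
noncomputable def CLD (k : ℕ) (x : Equiv.Perm ℤ) (i : ZMod (k + 1)) : ℕ :=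
  Set.ncard {j : ℤ | j < x.symm ((i.val : ℤ) + 1) ∧ (i.val : ℤ) + 1 < x j}

/-- The left increasing code: `CLI(x)_i = #{j > x⁻¹(ī) : x(j) < ī}`. -/
noncomputable def CLI (k : ℕ) (x : Equiv.Perm ℤ) (i : ZMod (k + 1)) : ℕ :=
  Set.ncard {j : ℤ | x.symm ((i.val : ℤ)) < j ∧ x j < (i.val : ℤ)}

section Rotation

variable {k : ℕ}

/-- The least integer greater than `m` whose residue lies in `S`. -/
noncomputable def nextIn (S : Finset (ZMod (k + 1))) (m : ℤ) : ℤ :=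
  sInf {b : ℤ | m < b ∧ (b : ZMod (k + 1)) ∈ S}

/-- The map sending each integer with residue in `S` to the next such integer, and fixing
all other integers. -/
noncomputable def rot (S : Finset (ZMod (k + 1))) (m : ℤ) : ℤ :=
  if (m : ZMod (k + 1)) ∈ S then nextIn S m else m

/-- The map interchanging every `j` of residue `p` with `j + δ`. -/
def reflect (p : ZMod (k + 1)) (δ : ℤ) (j : ℤ) : ℤ :=
  if (j : ZMod (k + 1)) = p then j + δ
  else if (j : ZMod (k + 1)) = p + δ then j - δ
  else j

theorem exists_lt_cast_mem {S : Finset (ZMod (k + 1))} (hS : S.Nonempty) (m : ℤ) :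
    ∃ b : ℤ, m < b ∧ (b : ZMod (k + 1)) ∈ S := by
  obtain ⟨s, hs⟩ := hS
  refine ⟨m + 1 + ((s - (m + 1)).val : ℤ), by omega, ?_⟩
  simpa using hs

theorem nextIn_spec {S : Finset (ZMod (k + 1))} (hS : S.Nonempty) (m : ℤ) :
    m < nextIn S m ∧ (nextIn S m : ZMod (k + 1)) ∈ S :=
  Int.csInf_mem (s := {b : ℤ | m < b ∧ (b : ZMod (k + 1)) ∈ S}) (exists_lt_cast_mem hS m)
    ⟨m, fun _ hb => hb.1.le⟩

theorem nextIn_le {S : Finset (ZMod (k + 1))} {m b : ℤ} (h : m < b)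
    (hb : (b : ZMod (k + 1)) ∈ S) : nextIn S m ≤ b :=
  csInf_le ⟨m, fun _ hb => hb.1.le⟩ ⟨h, hb⟩

theorem nextIn_eq {S : Finset (ZMod (k + 1))} {m b : ℤ} (h : m < b)
    (hb : (b : ZMod (k + 1)) ∈ S)
    (hc : ∀ c : ℤ, m < c → c < b → (c : ZMod (k + 1)) ∉ S) : nextIn S m = b := by
  have h1 := nextIn_spec ⟨_, hb⟩ m
  have h2 := nextIn_le h hb
  by_contra hne
  exact hc _ h1.1 (lt_of_le_of_ne h2 hne) h1.2

theorem nextIn_congr {S : Finset (ZMod (k + 1))} (hS : S.Nonempty) {m m' : ℤ}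
    (h : (m : ZMod (k + 1)) = m') : nextIn S m = nextIn S m' + (m - m') := by
  obtain ⟨h1, h2⟩ := nextIn_spec hS m'
  refine nextIn_eq (by omega) (by simpa [h] using h2) fun c hc1 hc2 hc => ?_
  have := nextIn_le (S := S) (m := m') (b := c - (m - m')) (by omega) (by simpa [h] using hc)
  omega

theorem cast_nextIn_congr {S : Finset (ZMod (k + 1))} (hS : S.Nonempty) {m m' : ℤ}
    (h : (m : ZMod (k + 1)) = m') :
    (nextIn S m : ZMod (k + 1)) = (nextIn S m' : ZMod (k + 1)) := by
  rw [nextIn_congr hS h]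
  simp [h]

theorem nextIn_injOn {S : Finset (ZMod (k + 1))} (hS : S.Nonempty) {x y : ℤ}
    (hx : (x : ZMod (k + 1)) ∈ S) (hy : (y : ZMod (k + 1)) ∈ S)
    (h : nextIn S x = nextIn S y) : x = y := by
  have h1 := (nextIn_spec hS x).1
  have h2 := (nextIn_spec hS y).1
  rcases lt_trichotomy x y with hlt | heq | hlt
  · have := nextIn_le hlt hy
    omega
  · exact heq
  · have := nextIn_le hlt hx
    omega

/-- Any point of `S` below `b` is followed by a last point of `S` below `b`. -/
theorem exists_last_lt {S : Finset (ZMod (k + 1))} {a b : ℤ} (hab : a < b)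
    (ha : (a : ZMod (k + 1)) ∈ S) :
    ∃ u : ℤ, a ≤ u ∧ u < b ∧ (u : ZMod (k + 1)) ∈ S ∧
      ∀ c : ℤ, u < c → c < b → (c : ZMod (k + 1)) ∉ S := by
  obtain ⟨u, ⟨hu1, hu2⟩, hu3⟩ := Int.exists_greatest_of_bdd
    (P := fun u => u < b ∧ (u : ZMod (k + 1)) ∈ S) ⟨b, fun z hz => hz.1.le⟩ ⟨a, hab, ha⟩
  exact ⟨u, hu3 a ⟨hab, ha⟩, hu1, hu2, fun c h1 h2 h3 => by have := hu3 c ⟨h2, h3⟩; omega⟩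

theorem rot_of_mem {S : Finset (ZMod (k + 1))} {m : ℤ} (h : (m : ZMod (k + 1)) ∈ S) :
    rot S m = nextIn S m := if_pos h

theorem rot_of_notMem {S : Finset (ZMod (k + 1))} {m : ℤ} (h : (m : ZMod (k + 1)) ∉ S) :
    rot S m = m := if_neg h

theorem cast_mem_of_between {S : Finset (ZMod (k + 1))} {p : ZMod (k + 1)} {δ : ℤ}
    (hgap : ∀ r : ℤ, 0 < r → r < δ → p + (r : ZMod (k + 1)) ∉ S) {y c : ℤ}
    (hy : (y : ZMod (k + 1)) = p) (h1 : y < c) (h2 : c < y + δ) :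
    (c : ZMod (k + 1)) ∉ S := by
  have := hgap (c - y) (by omega) (by omega)
  simpa [hy] using this

theorem rot_insert_left {S : Finset (ZMod (k + 1))} {p : ZMod (k + 1)} {δ : ℤ} (hδ : 0 < δ)
    (hp : p ∉ S) (hq : p + (δ : ZMod (k + 1)) ∈ S)
    (hgap : ∀ r : ℤ, 0 < r → r < δ → p + (r : ZMod (k + 1)) ∉ S) (x : ℤ) :
    rot (insert p S) x = reflect p δ (rot S x) := by
  have hS : S.Nonempty := ⟨_, hq⟩
  by_cases hx : (x : ZMod (k + 1)) ∈ S
  · obtain ⟨h1, h2⟩ := nextIn_spec hS x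
    have h3 : ∀ c : ℤ, x < c → c < nextIn S x → (c : ZMod (k + 1)) ∉ S := fun c hc hc' hcS => by
      have := nextIn_le hc hcS
      omega
    rw [rot_of_mem hx, rot_of_mem (Finset.mem_insert_of_mem hx)]
    generalize nextIn S x = y at h1 h2 h3
    have hyp : (y : ZMod (k + 1)) ≠ p := fun h => hp (h ▸ h2)
    by_cases hy : (y : ZMod (k + 1)) = p + δ
    · rw [reflect, if_neg hyp, if_pos hy]
      have hyδ : ((y - δ : ℤ) : ZMod (k + 1)) = p := by simp [hy]
      refine nextIn_eq ?_ (by simp [hyδ]) fun c hc1 hc2 hc => ?_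
      · by_contra hlt
        rcases eq_or_lt_of_le (not_lt.1 hlt) with he | hl
        · exact hp (by rw [← hyδ, he]; exact hx)
        · exact cast_mem_of_between hgap hyδ hl (by omega) hx
      · rcases Finset.mem_insert.1 hc with hc | hc
        · exact h3 (c + δ) (by omega) (by omega) (by simpa [hc] using hq)
        · exact h3 c hc1 (by omega) hc
    · rw [reflect, if_neg hyp, if_neg hy]
      refine nextIn_eq h1 (by simp [h2]) fun c hc1 hc2 hc => ?_
      rcases Finset.mem_insert.1 hc with hc | hc
      · rcases lt_trichotomy (c + δ) y with hl | he | hl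
        · exact h3 (c + δ) (by omega) hl (by simpa [hc] using hq)
        · exact hy (by simp [← he, hc])
        · exact cast_mem_of_between hgap hc hc2 hl h2
      · exact h3 c hc1 hc2 hc
  · rw [rot_of_notMem hx]
    by_cases hxp : (x : ZMod (k + 1)) = p
    · rw [rot_of_mem (by simp [hxp]), reflect, if_pos hxp]
      refine nextIn_eq (by omega) (by simp [hxp, hq]) fun c hc1 hc2 hc => ?_
      rcases Finset.mem_insert.1 hc with hc | hc
      · exact cast_mem_of_between hgap hc (c := x + δ) (by omega) (by omega)
          (by simpa [hxp] using hq)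
      · exact cast_mem_of_between hgap hxp hc1 hc2 hc
    · rw [rot_of_notMem (by simp [hxp, hx]), reflect, if_neg hxp,
        if_neg fun h => hx (by rwa [h])]

theorem rot_insert_right {S : Finset (ZMod (k + 1))} {p : ZMod (k + 1)} {δ : ℤ} (hδ : 0 < δ)
    (hp : p ∈ S) (hq : p + (δ : ZMod (k + 1)) ∉ S)
    (hgap : ∀ r : ℤ, 0 < r → r < δ → p + (r : ZMod (k + 1)) ∉ S) (x : ℤ) :
    rot (insert (p + (δ : ZMod (k + 1))) S) x = rot S (reflect p δ x) := by
  have hS : S.Nonempty := ⟨_, hp⟩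
  by_cases hxp : (x : ZMod (k + 1)) = p
  · rw [reflect, if_pos hxp, rot_of_mem (by simp [hxp, hp]),
      rot_of_notMem (by simpa [hxp] using hq)]
    refine nextIn_eq (by omega) (by simp [hxp]) fun c hc1 hc2 hc => ?_
    rcases Finset.mem_insert.1 hc with hc | hc
    · exact cast_mem_of_between hgap (y := c - δ) (c := x) (by simp [hc]) (by omega) (by omega)
        (by simpa [hxp] using hp)
    · exact cast_mem_of_between hgap hxp hc1 hc2 hc
  by_cases hxq : (x : ZMod (k + 1)) = p + δ
  · have hxδ : ((x - δ : ℤ) : ZMod (k + 1)) = p := by simp [hxq]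
    rw [reflect, if_neg hxp, if_pos hxq, rot_of_mem (by simp [hxq]), rot_of_mem (hxδ ▸ hp)]
    obtain ⟨h1, h2⟩ := nextIn_spec hS (x - δ)
    refine nextIn_eq ?_ (by simp [h2]) fun c hc1 hc2 hc => ?_
    · by_contra hle
      rcases eq_or_lt_of_le (not_lt.1 hle) with he | hl
      · exact hq (by rw [← hxq, ← he]; exact h2)
      · exact cast_mem_of_between hgap hxδ h1 (by omega) h2
    · rcases Finset.mem_insert.1 hc with hc | hc
      · have := nextIn_le (S := S) (m := x - δ) (b := c - δ) (by omega) (by simpa [hc] using hp)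
        omega
      · have := nextIn_le (S := S) (m := x - δ) (b := c) (by omega) hc
        omega
  · rw [reflect, if_neg hxp, if_neg hxq]
    by_cases hx : (x : ZMod (k + 1)) ∈ S
    · rw [rot_of_mem hx, rot_of_mem (Finset.mem_insert_of_mem hx)]
      obtain ⟨h1, h2⟩ := nextIn_spec hS x
      refine nextIn_eq h1 (by simp [h2]) fun c hc1 hc2 hc => ?_
      rcases Finset.mem_insert.1 hc with hc | hc
      · have hcδ : ((c - δ : ℤ) : ZMod (k + 1)) = p := by simp [hc]
        rcases lt_trichotomy (c - δ) x with hl | he | hl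
        · exact cast_mem_of_between hgap hcδ hl (by omega) hx
        · exact hxp (he ▸ hcδ)
        · have := nextIn_le hl (hcδ ▸ hp)
          omega
      · have := nextIn_le hc1 hc
        omega
    · rw [rot_of_notMem hx, rot_of_notMem (by simp [hxq, hx])]

theorem reflect_reflect {p : ZMod (k + 1)} {δ : ℤ} (h : p + (δ : ZMod (k + 1)) ≠ p) (x : ℤ) :
    reflect p δ (reflect p δ x) = x := by
  by_cases h1 : (x : ZMod (k + 1)) = p
  · simp [reflect, h1, h]
  · by_cases h2 : (x : ZMod (k + 1)) = p + δ
    · simp [reflect, h2, h]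
    · simp [reflect, h1, h2]

/-- If a point of `P \ Q` is followed in `P ∪ Q` by a point of `Q \ P`, then both points can be
added to both sets without changing the composite rotation. -/
theorem rot_rot_insert {P Q : Finset (ZMod (k + 1))} {m : ℤ} (hmP : (m : ZMod (k + 1)) ∈ P)
    (hmQ : (m : ZMod (k + 1)) ∉ Q) (hn : (nextIn (P ∪ Q) m : ZMod (k + 1)) ∉ P) (x : ℤ) :
    rot (insert (nextIn (P ∪ Q) m : ZMod (k + 1)) P) (rot (insert (m : ZMod (k + 1)) Q) x) =
      rot P (rot Q x) := by
  obtain ⟨h1, h2⟩ := nextIn_spec (S := P ∪ Q) ⟨m, Finset.mem_union_left _ hmP⟩ m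
  have hgap : ∀ r : ℤ, 0 < r → r < nextIn (P ∪ Q) m - m →
      (m : ZMod (k + 1)) + (r : ZMod (k + 1)) ∉ P ∪ Q := fun r hr1 hr2 hr => by
    have := nextIn_le (S := P ∪ Q) (m := m) (b := m + r) (by omega) (by simpa using hr)
    omega
  have hq : (nextIn (P ∪ Q) m : ZMod (k + 1)) =
      (m : ZMod (k + 1)) + ((nextIn (P ∪ Q) m - m : ℤ) : ZMod (k + 1)) := by simp
  have hQ : (nextIn (P ∪ Q) m : ZMod (k + 1)) ∈ Q := (Finset.mem_union.1 h2).resolve_left hn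
  rw [hq] at hn hQ ⊢
  rw [rot_insert_right (by omega) hmP hn
      fun r h h' hr => hgap r h h' (Finset.mem_union_left _ hr),
    rot_insert_left (by omega) hmQ hQ fun r h h' hr => hgap r h h' (Finset.mem_union_right _ hr),
    reflect_reflect fun h => hmQ (by rwa [h] at hQ)]

/-- The points of `Q` whose successor in `P ∪ Q` lies in `P`. -/
noncomputable def lastOf (P Q : Finset (ZMod (k + 1))) : Finset (ZMod (k + 1)) :=
  Q.filter fun a => (nextIn (P ∪ Q) (a.val : ℤ) : ZMod (k + 1)) ∈ P

theorem mem_lastOf {P Q : Finset (ZMod (k + 1))} (hP : P.Nonempty) {m : ℤ} :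
    (m : ZMod (k + 1)) ∈ lastOf P Q ↔
      (m : ZMod (k + 1)) ∈ Q ∧ (nextIn (P ∪ Q) m : ZMod (k + 1)) ∈ P := by
  rw [lastOf, Finset.mem_filter, cast_nextIn_congr (m := m) (hP.mono Finset.subset_union_left)
    (m' := ((m : ZMod (k + 1)).val : ℤ)) (by simp)]

theorem exists_lastOf {P Q : Finset (ZMod (k + 1))} (hP : P.Nonempty) {z : ℤ}
    (hz : (z : ZMod (k + 1)) ∈ Q) :
    ∃ w : ℤ, z ≤ w ∧ (w : ZMod (k + 1)) ∈ lastOf P Q ∧ nextIn (P ∪ Q) w = nextIn P z := by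
  obtain ⟨h1, h2⟩ := nextIn_spec hP z
  obtain ⟨w, hw1, hw2, hw3, hw4⟩ := exists_last_lt h1 hz
  have hw : nextIn (P ∪ Q) w = nextIn P z := by
    refine nextIn_eq hw2 (Finset.mem_union_left _ h2) fun c hc1 hc2 hc => ?_
    rcases Finset.mem_union.1 hc with hc | hc
    · have := nextIn_le (S := P) (m := z) (by omega) hc
      omega
    · exact hw4 c hc1 hc2 hc
  exact ⟨w, hw1, (mem_lastOf hP).2 ⟨hw3, hw ▸ h2⟩, hw⟩

theorem lastOf_nonempty {P Q : Finset (ZMod (k + 1))} (hP : P.Nonempty) (hQ : Q.Nonempty) :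
    (lastOf P Q).Nonempty := by
  obtain ⟨z, -, hz⟩ := exists_lt_cast_mem hQ 0
  obtain ⟨w, -, hw, -⟩ := exists_lastOf hP hz
  exact ⟨_, hw⟩

/-- If no point of `P \ Q` is followed in `P ∪ Q` by a point of `Q \ P`, then the composite
rotation can be rewritten with nested sets. -/
theorem rot_union_lastOf {P Q : Finset (ZMod (k + 1))} (hP : P.Nonempty) (hQ : Q.Nonempty)
    (h : ∀ m : ℤ, (m : ZMod (k + 1)) ∈ P → (m : ZMod (k + 1)) ∉ Q →
      (nextIn (P ∪ Q) m : ZMod (k + 1)) ∈ P) (x : ℤ) :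
    rot (P ∪ Q) (rot (lastOf P Q) x) = rot P (rot Q x) := by
  have hU : (P ∪ Q).Nonempty := hP.mono Finset.subset_union_left
  obtain ⟨hy1, hy2⟩ := nextIn_spec hU x
  have hy3 : ∀ c : ℤ, x < c → c < nextIn (P ∪ Q) x → (c : ZMod (k + 1)) ∉ P ∪ Q :=
    fun c hc hc' hcS => by
      have := nextIn_le hc hcS
      omega
  by_cases hxQ : (x : ZMod (k + 1)) ∈ Q
  · by_cases hy : (nextIn (P ∪ Q) x : ZMod (k + 1)) ∈ P
    · have hx' : (x : ZMod (k + 1)) ∈ lastOf P Q := (mem_lastOf hP).2 ⟨hxQ, hy⟩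
      obtain ⟨hz1, hz2⟩ := nextIn_spec hQ x
      have hzP : (nextIn Q x : ZMod (k + 1)) ∈ P := by
        by_contra hzP
        have hyz : nextIn (P ∪ Q) x < nextIn Q x :=
          lt_of_le_of_ne (nextIn_le hz1 (Finset.mem_union_right _ hz2))
            fun he => hzP (he ▸ hy)
        obtain ⟨u, hu1, hu2, hu3, hu4⟩ := exists_last_lt hyz hy2
        have huQ : (u : ZMod (k + 1)) ∉ Q := fun hu => by
          have := nextIn_le (S := Q) (m := x) (by omega) hu
          omega
        have hu := h u ((Finset.mem_union.1 hu3).resolve_right huQ) huQ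
        rw [nextIn_eq hu2 (Finset.mem_union_right _ hz2) hu4] at hu
        exact hzP hu
      obtain ⟨w, hw1, hw2, hw3⟩ := exists_lastOf hP hz2
      have hw4 := ((mem_lastOf hP).1 hw2).1
      have hwx : nextIn (lastOf P Q) x = w := by
        refine nextIn_eq (by omega) hw2 fun c hc1 hc2 hc => ?_
        obtain ⟨hc3, hc4⟩ := (mem_lastOf hP).1 hc
        have h1 := nextIn_le hc1 hc3
        have h2 := nextIn_le hc2 (Finset.mem_union_right P hw4)
        have h3 := nextIn_le (m := nextIn Q x) (by have := (nextIn_spec hU c).1; omega) hc4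
        have h4 := (nextIn_spec hU w).1
        omega
      rw [rot_of_mem hx', rot_of_mem hxQ, rot_of_mem hzP, hwx,
        rot_of_mem (Finset.mem_union_right _ hw4), hw3]
    · have hx' : (x : ZMod (k + 1)) ∉ lastOf P Q := fun hx' => hy ((mem_lastOf hP).1 hx').2
      rw [rot_of_notMem hx', rot_of_mem hxQ, rot_of_mem (Finset.mem_union_right _ hxQ),
        nextIn_eq (S := Q) hy1 ((Finset.mem_union.1 hy2).resolve_left hy)
          fun c h1 h2 hc => hy3 c h1 h2 (Finset.mem_union_right _ hc), rot_of_notMem hy]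
  · have hx' : (x : ZMod (k + 1)) ∉ lastOf P Q := fun hx' => hxQ ((mem_lastOf hP).1 hx').1
    rw [rot_of_notMem hx', rot_of_notMem hxQ]
    by_cases hxP : (x : ZMod (k + 1)) ∈ P
    · rw [rot_of_mem hxP, rot_of_mem (Finset.mem_union_left _ hxP),
        nextIn_eq (S := P) hy1 (h x hxP hxQ)
          fun c h1 h2 hc => hy3 c h1 h2 (Finset.mem_union_left _ hc)]
    · rw [rot_of_notMem hxP, rot_of_notMem (by simp [hxP, hxQ])]

theorem card_add_card_le_card_lastOf {P Q : Finset (ZMod (k + 1))} (hP : P.Nonempty) :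
    P.card + Q.card ≤ (P ∪ Q).card + (lastOf P Q).card := by
  have hU : (P ∪ Q).Nonempty := hP.mono Finset.subset_union_left
  have hle : (Q \ lastOf P Q).card ≤ (Q \ P).card := by
    refine Finset.card_le_card_of_injOn
      (fun a => (nextIn (P ∪ Q) (a.val : ℤ) : ZMod (k + 1))) (fun a ha => ?_)
      fun a ha b hb hab => ?_
    · obtain ⟨h1, h2⟩ := Finset.mem_sdiff.1 (Finset.mem_coe.1 ha)
      have h3 : (nextIn (P ∪ Q) (a.val : ℤ) : ZMod (k + 1)) ∉ P := fun h3 =>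
        h2 (Finset.mem_filter.2 ⟨h1, h3⟩)
      have h4 := (nextIn_spec hU (a.val : ℤ)).2
      exact Finset.mem_coe.2
        (Finset.mem_sdiff.2 ⟨(Finset.mem_union.1 h4).resolve_left h3, h3⟩)
    · have haQ := (Finset.mem_sdiff.1 (Finset.mem_coe.1 ha)).1
      have hbQ := (Finset.mem_sdiff.1 (Finset.mem_coe.1 hb)).1
      have hab : (nextIn (P ∪ Q) (a.val : ℤ) : ZMod (k + 1)) = nextIn (P ∪ Q) (b.val : ℤ) := hab
      set d : ℤ := nextIn (P ∪ Q) (a.val : ℤ) - nextIn (P ∪ Q) (b.val : ℤ) with hd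
      have hd0 : (d : ZMod (k + 1)) = 0 := by
        rw [hd, Int.cast_sub, hab, sub_self]
      have hb' : (((b.val : ℤ) + d : ℤ) : ZMod (k + 1)) = ((b.val : ℤ) : ZMod (k + 1)) := by
        simp [hd0]
      have := nextIn_congr hU hb'
      have he := nextIn_injOn hU (x := (a.val : ℤ)) (y := (b.val : ℤ) + d)
        (by simp [haQ]) (by simp [hbQ, hd0]) (by omega)
      have hc := congrArg (Int.cast : ℤ → ZMod (k + 1)) he
      simpa [hd0] using hc
  have h1 : lastOf P Q ⊆ Q := Finset.filter_subset _ _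
  have h2 := Finset.card_sdiff_add_card_eq_card h1
  have h3 := Finset.card_sdiff_add_card Q P
  rw [Finset.union_comm] at h3
  omega

theorem rot_univ (m : ℤ) : rot (Finset.univ : Finset (ZMod (k + 1))) m = m + 1 := by
  rw [rot_of_mem (Finset.mem_univ _)]
  exact nextIn_eq (by omega) (Finset.mem_univ _) fun c h1 h2 => by omega

theorem rot_image_add_one {S : Finset (ZMod (k + 1))} (hS : S.Nonempty) (m : ℤ) :
    rot (S.image (· + 1)) (m + 1) = rot S m + 1 := by
  have hmem : ∀ j : ℤ, ((j : ℤ) : ZMod (k + 1)) ∈ S.image (· + 1) ↔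
      ((j - 1 : ℤ) : ZMod (k + 1)) ∈ S := fun j => by
    simp only [Finset.mem_image, Int.cast_sub, Int.cast_one]
    exact ⟨fun ⟨a, ha, he⟩ => by simpa [← he] using ha, fun h => ⟨_, h, by simp⟩⟩
  by_cases hm : (m : ZMod (k + 1)) ∈ S
  · obtain ⟨h1, h2⟩ := nextIn_spec hS m
    rw [rot_of_mem hm, rot_of_mem ((hmem _).2 (by simpa using hm))]
    refine nextIn_eq (by omega) ((hmem _).2 (by simpa using h2)) fun c hc1 hc2 hc => ?_
    have := nextIn_le (m := m) (by omega) ((hmem _).1 hc)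
    omega
  · rw [rot_of_notMem hm, rot_of_notMem fun h => hm (by simpa using (hmem _).1 h)]

end Rotation

section CyclicallyDecreasing

variable {k : ℕ}

theorem one_ne_zero_zmod (hk : 1 ≤ k) : ¬ (1 : ZMod (k + 1)) = 0 := by
  have : Fact (1 < k + 1) := ⟨by omega⟩
  exact one_ne_zero

theorem sAff_apply (hk : 1 ≤ k) (i : ZMod (k + 1)) (j : ℤ) :
    sAff k i j = reflect i 1 j := by
  rw [sAff, dif_neg (one_ne_zero_zmod hk)]
  simp [reflect, sAffFun, Function.Involutive.toPerm]

theorem gate_notMem {A : Finset (ZMod (k + 1))} (hA : A ≠ Finset.univ) : gate k A ∉ A := by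
  have h : ∃ g, g ∉ A := by
    by_contra hc
    push Not at hc
    exact hA (Finset.eq_univ_iff_forall.2 hc)
  rw [gate, dif_pos h]
  exact h.choose_spec

theorem add_natCast_inj {g : ZMod (k + 1)} {s t : ℕ} (hs : s < k + 1) (ht : t < k + 1)
    (h : g + (s : ZMod (k + 1)) = g + (t : ZMod (k + 1))) : s = t := by
  have h := congrArg ZMod.val (add_left_cancel h)
  rwa [ZMod.val_natCast_of_lt hs, ZMod.val_natCast_of_lt ht] at h

theorem prod_sAff_apply (hk : 1 ≤ k) {A : Finset (ZMod (k + 1))} {g : ZMod (k + 1)} (hg : g ∉ A)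
    (T : ℕ) (hT : T ≤ k + 1) (m : ℤ) :
    ((((List.range T).reverse.map fun t : ℕ => g + (t : ZMod (k + 1))).filter
      fun a => decide (a ∈ A)).map (sAff k)).prod m =
    rot (A ∩ (Finset.range T).image fun t : ℕ => g + (t : ZMod (k + 1)))ᶜ (m - 1) := by
  induction T generalizing m with
  | zero => simp [rot_univ]
  | succ T ih =>
    rw [List.range_succ, List.reverse_append, List.reverse_singleton, List.singleton_append,
      List.map_cons, Finset.range_add_one, Finset.image_insert]
    by_cases hx : g + (T : ZMod (k + 1)) ∈ A
    · rw [List.filter_cons_of_pos (by simpa using hx), List.map_cons, List.prod_cons,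
        Equiv.Perm.mul_apply, ih (by omega), sAff_apply hk]
      set x := g + (T : ZMod (k + 1)) with hxdef
      set I := (Finset.range T).image fun t : ℕ => g + (t : ZMod (k + 1)) with hI
      have hxI : x ∉ I := fun h => by
        obtain ⟨t, ht, he⟩ := Finset.mem_image.1 h
        have ht := Finset.mem_range.1 ht
        have := add_natCast_inj (by omega) (by omega) he
        omega
      have hxI' : x + 1 ∉ A ∩ I := fun h => by
        obtain ⟨hA, h⟩ := Finset.mem_inter.1 h
        rcases Nat.lt_or_ge (T + 1) (k + 1) with hlt | hge
        · obtain ⟨t, ht, he⟩ := Finset.mem_image.1 h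
          have ht := Finset.mem_range.1 ht
          have := add_natCast_inj (s := t) (t := T + 1) (g := g) (by omega) hlt
            (by rw [he, hxdef]; push_cast; ring)
          omega
        · have hTk : T = k := by omega
          have : ((k + 1 : ℕ) : ZMod (k + 1)) = 0 := ZMod.natCast_self _
          push_cast at this
          rw [hxdef, hTk, add_assoc, this, add_zero] at hA
          exact hg hA
      have hne : x + 1 ≠ x := fun h => one_ne_zero_zmod hk (by simpa using h)
      have hins : (A ∩ I)ᶜ = insert x (A ∩ insert x I)ᶜ := by
        ext a
        by_cases ha : a = x
        · simp [ha, hxI]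
        · simp [ha]
      rw [hins, rot_insert_left one_pos (by simp [hx]) _ (fun r h1 h2 => by omega),
        reflect_reflect (by simpa using hne)]
      rw [Finset.mem_inter, not_and_or] at hxI'
      simpa [hne, -add_eq_left, Finset.compl_inter] using hxI'
    · rw [List.filter_cons_of_neg (by simpa using hx), ih (by omega),
        Finset.inter_insert_of_notMem hx]

theorem dElt_apply (hk : 1 ≤ k) {A : Finset (ZMod (k + 1))} (hA : A ≠ Finset.univ) (m : ℤ) :
    dElt k A m = rot Aᶜ (m - 1) := by
  rw [dElt, prod_sAff_apply hk (gate_notMem hA) _ le_rfl]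
  congr 2
  refine Finset.inter_eq_left.2 fun a _ => Finset.mem_image.2
    ⟨(a - gate k A).val, Finset.mem_range.2 (ZMod.val_lt _), by simp⟩

theorem exists_word_dElt (A : Finset (ZMod (k + 1))) :
    ∃ w : List (ZMod (k + 1)), w.length ≤ A.card ∧ dElt k A = (w.map (sAff k)).prod := by
  refine ⟨_, ?_, rfl⟩
  rw [← List.toFinset_card_of_nodup]
  · refine Finset.card_le_card fun a ha => ?_
    simp only [List.mem_toFinset, List.mem_filter, decide_eq_true_eq] at ha
    exact ha.2
  · refine (List.Nodup.map_on (fun s hs t ht h => ?_)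
      (List.nodup_reverse.2 List.nodup_range)).filter _
    exact add_natCast_inj (by simpa using hs) (by simpa using ht) h

theorem affLen_dElt_mul_le (A B : Finset (ZMod (k + 1))) :
    affLen k (dElt k B * dElt k A) ≤ A.card + B.card := by
  obtain ⟨v, hv, hv'⟩ := exists_word_dElt A
  obtain ⟨w, hw, hw'⟩ := exists_word_dElt B
  have : affLen k (dElt k B * dElt k A) ≤ (w ++ v).length :=
    Nat.sInf_le ⟨w ++ v, rfl, by rw [hv', hw', List.map_append, List.prod_append]⟩
  rw [List.length_append] at this
  omega

theorem compl_ne_univ {S : Finset (ZMod (k + 1))} (hS : S.Nonempty) : Sᶜ ≠ Finset.univ :=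
  fun h => hS.ne_empty (by simpa using h)

theorem card_image_add_one (S : Finset (ZMod (k + 1))) : (S.image (· + 1)).card = S.card :=
  Finset.card_image_of_injective _ (add_left_injective 1)

theorem dElt_compl_mul_apply (hk : 1 ≤ k) {P Q : Finset (ZMod (k + 1))} (hP : P.Nonempty)
    (hQ : Q.Nonempty) (m : ℤ) :
    (dElt k Pᶜ * dElt k (Q.image (· + 1))ᶜ) m = rot P (rot Q (m - 2)) := by
  rw [Equiv.Perm.mul_apply, dElt_apply hk (compl_ne_univ (hQ.image _)),
    dElt_apply hk (compl_ne_univ hP), compl_compl, compl_compl,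
    show m - 1 = (m - 2) + 1 by ring, rot_image_add_one hQ, add_sub_cancel_right]

end CyclicallyDecreasing

/-- a reduced product `d_B d_A` can be rewritten as `d_{B'} d_{A'}`
with the same total size and `B' ⊆ A' − 1`. -/
theorem two_row_reduction (k : ℕ) (hk : 1 ≤ k) (A B : Finset (ZMod (k + 1)))
    (hA : A ≠ Finset.univ) (hB : B ≠ Finset.univ)
    (hred : affLen k (dElt k B * dElt k A) = A.card + B.card) :
    ∃ A' B' : Finset (ZMod (k + 1)), A' ≠ Finset.univ ∧ B' ≠ Finset.univ ∧
      dElt k B' * dElt k A' = dElt k B * dElt k A ∧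
      A'.card + B'.card = A.card + B.card ∧
      B' ⊆ A'.image (fun a => a - 1) := by
  obtain ⟨P, rfl⟩ : ∃ P : Finset (ZMod (k + 1)), B = Pᶜ := ⟨Bᶜ, by simp⟩
  obtain ⟨Q, rfl⟩ : ∃ Q : Finset (ZMod (k + 1)), A = (Q.image (· + 1))ᶜ :=
    ⟨Aᶜ.image (· - 1), by simp [Finset.image_image, Function.comp_def]⟩
  have hP : P.Nonempty := Finset.nonempty_iff_ne_empty.2 fun h => hB (by simp [h])
  have hQ : Q.Nonempty := Finset.nonempty_iff_ne_empty.2 fun h => hA (by simp [h])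
  have key : ∀ P' Q' : Finset (ZMod (k + 1)), P'.Nonempty → Q'.Nonempty →
      (∀ x, rot P' (rot Q' x) = rot P (rot Q x)) →
      dElt k P'ᶜ * dElt k (Q'.image (· + 1))ᶜ = dElt k Pᶜ * dElt k (Q.image (· + 1))ᶜ ∧
        P'.card + Q'.card ≤ P.card + Q.card := by
    intro P' Q' hP' hQ' h
    have he : dElt k P'ᶜ * dElt k (Q'.image (· + 1))ᶜ =
        dElt k Pᶜ * dElt k (Q.image (· + 1))ᶜ := Equiv.ext fun m => by
      rw [dElt_compl_mul_apply hk hP' hQ', dElt_compl_mul_apply hk hP hQ, h]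
    refine ⟨he, ?_⟩
    have hlen := affLen_dElt_mul_le (Q'.image (· + 1))ᶜ P'ᶜ
    rw [he, hred] at hlen
    simp only [Finset.card_compl, card_image_add_one] at hlen
    have h1 := Finset.card_le_univ P
    have h2 := Finset.card_le_univ Q
    have h3 := Finset.card_le_univ P'
    have h4 := Finset.card_le_univ Q'
    omega
  have hno : ∀ m : ℤ, (m : ZMod (k + 1)) ∈ P → (m : ZMod (k + 1)) ∉ Q →
      (nextIn (P ∪ Q) m : ZMod (k + 1)) ∈ P := by
    intro m hmP hmQ
    by_contra hn
    have := (key _ _ (Finset.insert_nonempty _ _) (Finset.insert_nonempty _ _)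
      (rot_rot_insert hmP hmQ hn)).2
    rw [Finset.card_insert_of_notMem hn, Finset.card_insert_of_notMem hmQ] at this
    omega
  have hU : (P ∪ Q).Nonempty := hP.mono Finset.subset_union_left
  have hL := lastOf_nonempty hP hQ
  obtain ⟨he, hle⟩ := key _ _ hU hL (rot_union_lastOf hP hQ hno)
  refine ⟨((lastOf P Q).image (· + 1))ᶜ, (P ∪ Q)ᶜ, compl_ne_univ (hL.image _), compl_ne_univ hU,
    he, ?_, fun b hb => Finset.mem_image.2 ⟨b + 1, ?_, by simp⟩⟩
  · have hge := card_add_card_le_card_lastOf (Q := Q) hP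
    simp only [Finset.card_compl, card_image_add_one]
    have h1 := Finset.card_le_univ P
    have h2 := Finset.card_le_univ Q
    have h3 := Finset.card_le_univ (P ∪ Q)
    have h4 := Finset.card_le_univ (lastOf P Q)
    omega
  · have hbQ : b ∉ lastOf P Q := fun h =>
      Finset.mem_compl.1 hb (Finset.mem_union_right _ (Finset.mem_filter.1 h).1)
    simpa using hbQ
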